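/- arXiv:1807.10905 — 2 statements merged into one kernel-verified Lean document; each statement's English description precedes it below -/
import Mathlib

section
/- Let n ≥ 4. The set 𝒯 satisfies: (1) 𝒯₂ ⊆ 𝒯; (2) SPAN(𝒯) is closed under pointwise multiplication, i.e. if u, v ∈ SPAN(𝒯) then u·v ∈ SPAN(𝒯); (3) for every u ∈ 𝒯 and every i ∈ {1,…,n}, the partial derivative ∂u/∂x_i (taken on ℝⁿ∖{0}) belongs to SPAN(𝒯). -/
open Real
open scoped BigOperators

noncomputable section

abbrev E (n : ℕ) := EuclideanSpace ℝ (Fin n)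

/-- The Euclidean Laplacian of `f` at `x` (sum of second partial derivatives). -/
def lap (n : ℕ) (f : E n → ℝ) (x : E n) : ℝ :=
  ∑ i : Fin n, fderiv ℝ (fun y => fderiv ℝ f y (EuclideanSpace.single i 1)) x
    (EuclideanSpace.single i 1)

/-- `f` is a (real) polynomial function on `ℝⁿ`. -/
def IsPolyFun (n : ℕ) (f : E n → ℝ) : Prop :=
  ∃ P : MvPolynomial (Fin n) ℝ, ∀ x : E n, f x = MvPolynomial.eval (fun i => x i) P

/-- `p` is a harmonic homogeneous polynomial of degree `m` on `ℝⁿ`. -/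
def IsHHP (n m : ℕ) (p : E n → ℝ) : Prop :=
  IsPolyFun n p ∧ (∀ (c : ℝ) (x : E n), p (c • x) = c ^ m * p x) ∧ ∀ x : E n, lap n p x = 0

/-- The set `𝒯₁` of leading harmonic terms `|x|^{2-n-2k} p(x)`, `k ≥ 1`. -/
def T1 (n : ℕ) : Set (E n → ℝ) :=
  {f | ∃ (k : ℕ) (p : E n → ℝ), 1 ≤ k ∧ IsHHP n k p ∧
    f = fun x => ‖x‖ ^ ((2:ℝ) - n - 2 * k) * p x}

/-- The set `𝒯₂` of functions `|x|^{(2-n)l-k-m} p(x)`, `k ≥ l ≥ 1`, `k ≥ m`, `k - m` even. -/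
def T2 (n : ℕ) : Set (E n → ℝ) :=
  {f | ∃ (l k m : ℕ) (p : E n → ℝ), IsHHP n m p ∧ 1 ≤ l ∧ l ≤ k ∧ m ≤ k ∧ Even (k - m) ∧
    f = fun x => ‖x‖ ^ (((2:ℝ) - n) * l - k - m) * p x}

/-- The set `𝒯` of functions `|x|^{σ-m} p(x)`, `σ = 2j - (n-2)l - k`,
`k ≥ l ≥ j+1`, `k ≥ m`, `k - m` even. -/
def Tset (n : ℕ) : Set (E n → ℝ) :=
  {f | ∃ (j l k m : ℕ) (p : E n → ℝ), IsHHP n m p ∧ j + 1 ≤ l ∧ l ≤ k ∧ m ≤ k ∧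
    Even (k - m) ∧
    f = fun x => ‖x‖ ^ ((2 * (j:ℝ) - ((n:ℝ) - 2) * l - k) - m) * p x}

/-- The set `𝒯̃` (on `ℝ⁴`) of functions `|x|^{-2l-k-m} (log|x|)^i p(x)`,
`l ≥ 1`, `k ≥ l + i`, `k ≥ m`, `k - m` even. -/
def Ttilde : Set (E 4 → ℝ) :=
  {f | ∃ (l k i m : ℕ) (p : E 4 → ℝ), IsHHP 4 m p ∧ 1 ≤ l ∧ l + i ≤ k ∧ m ≤ k ∧
    Even (k - m) ∧
    f = fun x => ‖x‖ ^ (-(2 * (l:ℝ)) - k - m) * (Real.log ‖x‖) ^ i * p x}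

open MvPolynomial in
/-- The Laplacian of a polynomial, as a linear map on polynomials. -/
def polyLaplacian (n : ℕ) : MvPolynomial (Fin n) ℝ →ₗ[ℝ] MvPolynomial (Fin n) ℝ :=
  ∑ i : Fin n, (pderiv i).toLinearMap ∘ₗ (pderiv i).toLinearMap

/-- The polynomial `∑ Xᵢ²`, whose value at `x` is `‖x‖²`. -/
def normSqPoly (n : ℕ) : MvPolynomial (Fin n) ℝ :=
  ∑ i : Fin n, MvPolynomial.X i ^ 2

/-- The polynomials `‖x‖^{2s} h` of degree `d`, where `h` is homogeneous and harmonic. -/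
def harmonicMultiples (n d : ℕ) : Set (MvPolynomial (Fin n) ℝ) :=
  {f | ∃ (s m : ℕ) (h : MvPolynomial (Fin n) ℝ), h.IsHomogeneous m ∧ polyLaplacian n h = 0 ∧
    2 * s + m = d ∧ f = normSqPoly n ^ s * h}

section HarmonicDecomposition

open MvPolynomial

variable {n : ℕ}

lemma polyLaplacian_apply (f : MvPolynomial (Fin n) ℝ) :
    polyLaplacian n f = ∑ i : Fin n, pderiv i (pderiv i f) := by
  simp [polyLaplacian]

lemma normSqPoly_isHomogeneous : (normSqPoly n).IsHomogeneous 2 :=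
  IsHomogeneous.sum _ _ _ fun i _ => isHomogeneous_X_pow i 2

lemma pderiv_normSqPoly (i : Fin n) : pderiv i (normSqPoly n) = 2 * X i := by
  classical
  simp only [normSqPoly, map_sum, pderiv_pow, pderiv_X]
  rw [Finset.sum_eq_single i]
  · simp
  · intro j _ hj
    simp [hj]
  · simp

lemma polyLaplacian_normSqPoly_mul {f : MvPolynomial (Fin n) ℝ} {d : ℕ}
    (hf : f.IsHomogeneous d) :
    polyLaplacian n (normSqPoly n * f) =
      C (2 * n + 4 * d : ℝ) * f + normSqPoly n * polyLaplacian n f := by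
  have key : ∀ i : Fin n, pderiv i (pderiv i (normSqPoly n * f)) =
      2 * f + 4 * (X i * pderiv i f) + normSqPoly n * pderiv i (pderiv i f) := by
    intro i
    have h2 : pderiv i (2 : MvPolynomial (Fin n) ℝ) = 0 := (pderiv i).map_natCast 2
    simp only [pderiv_mul, pderiv_normSqPoly, map_add, pderiv_X_self, h2]
    ring
  rw [polyLaplacian_apply, polyLaplacian_apply, Finset.sum_congr rfl fun i _ => key i,
    Finset.sum_add_distrib, Finset.sum_add_distrib, ← Finset.mul_sum, ← Finset.mul_sum,
    hf.sum_X_mul_pderiv]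
  simp only [Finset.sum_const, Finset.card_univ, Fintype.card_fin, nsmul_eq_mul, map_add, map_mul,
    map_natCast, map_ofNat, Finset.mul_sum]
  ring

lemma exists_polyLaplacian_normSqPoly_pow_mul (hn : 0 < n) {h : MvPolynomial (Fin n) ℝ} {m : ℕ}
    (hh : h.IsHomogeneous m) (hΔ : polyLaplacian n h = 0) (s : ℕ) :
    ∃ c : ℝ, 0 < c ∧
      polyLaplacian n (normSqPoly n ^ (s + 1) * h) = C c * (normSqPoly n ^ s * h) := by
  have hn' : (0 : ℝ) < n := by exact_mod_cast hn
  induction s with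
  | zero =>
    refine ⟨2 * n + 4 * m, by positivity, ?_⟩
    simp [polyLaplacian_normSqPoly_mul hh, hΔ]
  | succ s ih =>
    obtain ⟨c, hc, h1⟩ := ih
    refine ⟨2 * n + 4 * ((2 * (s + 1) + m : ℕ) : ℝ) + c, by positivity, ?_⟩
    rw [pow_succ', mul_assoc,
      polyLaplacian_normSqPoly_mul ((normSqPoly_isHomogeneous.pow (s + 1)).mul hh), h1, map_add C _ c]
    ring

lemma exists_polyLaplacian_eq (hn : 0 < n) (d : ℕ) {f : MvPolynomial (Fin n) ℝ}
    (hf : f ∈ Submodule.span ℝ (harmonicMultiples n d)) :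
    ∃ g ∈ Submodule.span ℝ (harmonicMultiples n (d + 2)), polyLaplacian n g = f := by
  have hle : Submodule.span ℝ (harmonicMultiples n d) ≤
      (Submodule.span ℝ (harmonicMultiples n (d + 2))).map (polyLaplacian n) := by
    refine Submodule.span_le.2 ?_
    rintro _ ⟨s, m, h, hh, hΔ, hd, rfl⟩
    obtain ⟨c, hc, h1⟩ := exists_polyLaplacian_normSqPoly_pow_mul hn hh hΔ s
    refine ⟨c⁻¹ • (normSqPoly n ^ (s + 1) * h),
      Submodule.smul_mem _ _ (Submodule.subset_span ⟨s + 1, m, h, hh, hΔ, by omega, rfl⟩), ?_⟩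
    rw [map_smul, h1, ← smul_eq_C_mul, smul_smul, inv_mul_cancel₀ hc.ne', one_smul]
  exact hle hf

lemma isHomogeneous_of_mem_span_harmonicMultiples {d : ℕ} {f : MvPolynomial (Fin n) ℝ}
    (hf : f ∈ Submodule.span ℝ (harmonicMultiples n d)) : f.IsHomogeneous d := by
  have hle : Submodule.span ℝ (harmonicMultiples n d) ≤ homogeneousSubmodule (Fin n) ℝ d := by
    refine Submodule.span_le.2 ?_
    rintro _ ⟨s, m, h, hh, -, rfl, rfl⟩
    exact (normSqPoly_isHomogeneous.pow s).mul hh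
  exact hle hf

/-- Every homogeneous polynomial is a sum of products of powers of `‖x‖²` with harmonic
homogeneous polynomials. -/
lemma mem_span_harmonicMultiples (hn : 0 < n) (d : ℕ) {P : MvPolynomial (Fin n) ℝ}
    (hP : P.IsHomogeneous d) : P ∈ Submodule.span ℝ (harmonicMultiples n d) := by
  have of_harmonic : ∀ {d : ℕ} {P : MvPolynomial (Fin n) ℝ}, P.IsHomogeneous d →
      polyLaplacian n P = 0 → P ∈ Submodule.span ℝ (harmonicMultiples n d) :=
    fun {d P} hP hΔ => Submodule.subset_span ⟨0, d, P, hP, hΔ, by simp, by simp⟩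
  have hom : ∀ {d : ℕ} {P : MvPolynomial (Fin n) ℝ}, P.IsHomogeneous d →
      (polyLaplacian n P).IsHomogeneous (d - 1 - 1) := fun {d P} hP => by
    rw [polyLaplacian_apply]
    exact IsHomogeneous.sum _ _ _ fun i _ => hP.pderiv.pderiv
  induction d using Nat.strong_induction_on generalizing P with
  | _ d ih =>
    rcases Nat.lt_or_ge d 2 with hd | hd
    · refine of_harmonic hP ?_
      rw [polyLaplacian_apply]
      refine Finset.sum_eq_zero fun i _ => ?_
      have h0 : (pderiv i P).IsHomogeneous 0 := by
        have := hP.pderiv (i := i)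
        rwa [show d - 1 = 0 by omega] at this
      rw [← totalDegree_zero_iff_isHomogeneous, totalDegree_eq_zero_iff_eq_C] at h0
      rw [h0, pderiv_C]
    · obtain ⟨e, rfl⟩ := Nat.exists_eq_add_of_le' hd
      obtain ⟨g, hg, hgP⟩ := exists_polyLaplacian_eq hn e (ih e (by omega) (hom hP))
      have h1 := of_harmonic (hP.sub (isHomogeneous_of_mem_span_harmonicMultiples hg))
        (by rw [map_sub, hgP, sub_self])
      simpa using Submodule.add_mem _ h1 hg

end HarmonicDecomposition

section PolynomialFunctions

open MvPolynomial

variable {n : ℕ}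

lemma eval_normSqPoly (x : E n) : eval (fun i => x i) (normSqPoly n) = ‖x‖ ^ 2 := by
  simp [normSqPoly, EuclideanSpace.real_norm_sq_eq]

lemma hasFDerivAt_eval (P : MvPolynomial (Fin n) ℝ) (x : E n) :
    HasFDerivAt (fun y : E n => eval (fun i => y i) P)
      (∑ i, eval (fun i => x i) (pderiv i P) • (EuclideanSpace.proj i : E n →L[ℝ] ℝ)) x := by
  classical
  induction P using MvPolynomial.induction_on with
  | C a => simpa using hasFDerivAt_const a x
  | add p q hp hq =>
    simp only [map_add]
    refine (hp.add hq).congr_fderiv ?_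
    simp [add_smul, Finset.sum_add_distrib]
  | mul_X p j hp =>
    have hj : HasFDerivAt (fun y : E n => y j) (EuclideanSpace.proj j : E n →L[ℝ] ℝ) x :=
      (EuclideanSpace.proj j : E n →L[ℝ] ℝ).hasFDerivAt
    have h := hp.mul hj
    simp only [eval_mul, eval_X]
    refine h.congr_fderiv ?_
    ext v
    simp [pderiv_X, Pi.single_apply, apply_ite, Finset.mul_sum, add_mul, Finset.sum_add_distrib]
    ac_rfl

lemma fderiv_eval_single (P : MvPolynomial (Fin n) ℝ) (x : E n) (i : Fin n) :
    fderiv ℝ (fun y : E n => eval (fun i => y i) P) x (EuclideanSpace.single i 1) =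
      eval (fun i => x i) (pderiv i P) := by
  rw [(hasFDerivAt_eval P x).fderiv]
  simp

lemma lap_eval (P : MvPolynomial (Fin n) ℝ) (x : E n) :
    lap n (fun y => eval (fun i => y i) P) x = eval (fun i => x i) (polyLaplacian n P) := by
  simp only [lap, fderiv_eval_single, polyLaplacian_apply, map_sum]

lemma eval_smul_of_isHomogeneous {P : MvPolynomial (Fin n) ℝ} {d : ℕ} (hP : P.IsHomogeneous d)
    (c : ℝ) (x : Fin n → ℝ) : eval (fun i => c * x i) P = c ^ d * eval x P := by
  rw [eval_eq, eval_eq, Finset.mul_sum]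
  refine Finset.sum_congr rfl fun s hs => ?_
  rw [hP.degree_eq_sum_deg_support hs, ← Finset.prod_pow_eq_pow_sum]
  simp only [mul_pow, Finset.prod_mul_distrib]
  ring

lemma isHHP_eval {P : MvPolynomial (Fin n) ℝ} {m : ℕ} (hP : P.IsHomogeneous m)
    (hΔ : polyLaplacian n P = 0) : IsHHP n m fun x => eval (fun i => x i) P := by
  refine ⟨⟨P, fun _ => rfl⟩, fun c x => ?_, fun x => by rw [lap_eval, hΔ, map_zero]⟩
  simpa using eval_smul_of_isHomogeneous hP c fun i => x i

/-- The polynomial function underlying a harmonic homogeneous polynomial comes from a homogeneous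
polynomial. -/
lemma IsHHP.exists_isHomogeneous {m : ℕ} {p : E n → ℝ} (hp : IsHHP n m p) :
    ∃ P : MvPolynomial (Fin n) ℝ, P.IsHomogeneous m ∧ ∀ x : E n, p x = eval (fun i => x i) P := by
  obtain ⟨⟨P, hP⟩, hom, -⟩ := hp
  refine ⟨homogeneousComponent m P, homogeneousComponent_isHomogeneous m P, fun x => ?_⟩
  have hpoly : ∑ i ∈ Finset.range (P.totalDegree + 1),
      Polynomial.monomial i (eval (fun j => x j) (homogeneousComponent i P)) =
      Polynomial.monomial m (p x) := by
    refine Polynomial.funext fun c => ?_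
    have h1 : p (c • x) = ∑ i ∈ Finset.range (P.totalDegree + 1),
        c ^ i * eval (fun j => x j) (homogeneousComponent i P) := by
      rw [hP]
      conv_lhs => rw [← sum_homogeneousComponent P]
      rw [map_sum]
      exact Finset.sum_congr rfl fun i _ =>
        eval_smul_of_isHomogeneous (homogeneousComponent_isHomogeneous i P) c _
    rw [hom] at h1
    simp only [Polynomial.eval_finsetSum, Polynomial.eval_monomial, mul_comm _ (c ^ _), h1]
  have hcoeff := congrArg (fun q => Polynomial.coeff q m) hpoly
  simp only [Polynomial.finsetSum_coeff, Polynomial.coeff_monomial, Finset.sum_ite_eq',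
    Finset.mem_range, if_true] at hcoeff
  rw [← hcoeff]
  split_ifs with h
  · rfl
  · rw [homogeneousComponent_eq_zero m P (by omega), map_zero]

end PolynomialFunctions

section Tset

open MvPolynomial

variable {n : ℕ}

/-- The functions that agree on `ℝⁿ∖{0}` with an element of the span of `𝒯`. -/
def spanTset (n : ℕ) : Submodule ℝ (E n → ℝ) where
  carrier := {f | ∃ w ∈ Submodule.span ℝ (Tset n), ∀ x : E n, x ≠ 0 → f x = w x}
  zero_mem' := ⟨0, Submodule.zero_mem _, fun _ _ => rfl⟩
  add_mem' := by
    rintro f g ⟨u, hu, hfu⟩ ⟨v, hv, hgv⟩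
    exact ⟨u + v, Submodule.add_mem _ hu hv, fun x hx => by simp [hfu x hx, hgv x hx]⟩
  smul_mem' := by
    rintro c f ⟨u, hu, hfu⟩
    exact ⟨c • u, Submodule.smul_mem _ c hu, fun x hx => by simp [hfu x hx]⟩

lemma mem_spanTset_of_eqOn {f g : E n → ℝ} (hf : f ∈ spanTset n)
    (h : ∀ x : E n, x ≠ 0 → g x = f x) : g ∈ spanTset n := by
  obtain ⟨w, hw, hfw⟩ := hf
  exact ⟨w, hw, fun x hx => (h x hx).trans (hfw x hx)⟩

lemma norm_rpow_mul_eval_mem_spanTset (hn : 0 < n) {j l k d : ℕ} (hjl : j + 1 ≤ l) (hlk : l ≤ k)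
    (hdk : d ≤ k) (heven : Even (k - d)) {P : MvPolynomial (Fin n) ℝ} (hP : P.IsHomogeneous d) :
    (fun x : E n => ‖x‖ ^ ((2 * (j : ℝ) - ((n : ℝ) - 2) * l - k) - d) * eval (fun i => x i) P) ∈
      spanTset n := by
  set a : ℝ := 2 * (j : ℝ) - ((n : ℝ) - 2) * l - k with ha
  induction mem_span_harmonicMultiples hn d hP using Submodule.span_induction with
  | mem f hf =>
    obtain ⟨s, m, h, hh, hΔ, rfl, rfl⟩ := hf
    refine ⟨fun x => ‖x‖ ^ (a - m) * eval (fun i => x i) h,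
      Submodule.subset_span ⟨j, l, k, m, _, isHHP_eval hh hΔ, hjl, hlk, by omega, ?_, rfl⟩,
      fun x hx => ?_⟩
    · rw [show k - m = (k - (2 * s + m)) + 2 * s by omega]
      exact heven.add (even_two_mul s)
    · beta_reduce
      rw [eval_mul, map_pow, eval_normSqPoly, ← mul_assoc, ← pow_mul, ← Real.rpow_natCast,
        ← Real.rpow_add (norm_pos_iff.2 hx)]
      push_cast
      ring_nf
  | zero => exact mem_spanTset_of_eqOn (spanTset n).zero_mem fun x _ => by simp
  | add f g hf hg hf' hg' =>
    have := (spanTset n).add_mem (hf' (isHomogeneous_of_mem_span_harmonicMultiples hf))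
      (hg' (isHomogeneous_of_mem_span_harmonicMultiples hg))
    refine mem_spanTset_of_eqOn this fun x _ => ?_
    simp [mul_add]
  | smul c f hf hf' =>
    refine mem_spanTset_of_eqOn ((spanTset n).smul_mem c
      (hf' (isHomogeneous_of_mem_span_harmonicMultiples hf))) fun x _ => ?_
    simp [mul_left_comm]

lemma mul_mem_spanTset_of_mem_Tset (hn : 0 < n) {u v : E n → ℝ} (hu : u ∈ Tset n)
    (hv : v ∈ Tset n) : u * v ∈ spanTset n := by
  obtain ⟨j, l, k, m, p, hp, hjl, hlk, hmk, he, rfl⟩ := hu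
  obtain ⟨j', l', k', m', p', hp', hjl', hlk', hmk', he', rfl⟩ := hv
  obtain ⟨P, hP, hpP⟩ := hp.exists_isHomogeneous
  obtain ⟨P', hP', hpP'⟩ := hp'.exists_isHomogeneous
  have heven : Even (k + k' - (m + m')) := by
    rw [show k + k' - (m + m') = (k - m) + (k' - m') by omega]
    exact he.add he'
  refine mem_spanTset_of_eqOn (norm_rpow_mul_eval_mem_spanTset hn
    (show (j + j') + 1 ≤ l + l' by omega) (show l + l' ≤ k + k' by omega) (by omega) heven
    (hP.mul hP')) fun x hx => ?_
  rw [Pi.mul_apply, eval_mul, ← hpP, ← hpP', mul_mul_mul_comm,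
    ← Real.rpow_add (norm_pos_iff.2 hx)]
  push_cast
  ring_nf

lemma mul_mem_spanTset (hn : 0 < n) {u v : E n → ℝ} (hu : u ∈ Submodule.span ℝ (Tset n))
    (hv : v ∈ Submodule.span ℝ (Tset n)) : u * v ∈ spanTset n := by
  have huv := Submodule.mul_mem_mul hu hv
  rw [Submodule.span_mul_span] at huv
  refine Submodule.span_le.2 ?_ huv
  rintro _ ⟨f, hf, g, hg, rfl⟩
  exact mul_mem_spanTset_of_mem_Tset hn hf hg

lemma fderiv_norm_rpow_mul_eval_single (a : ℝ) (P : MvPolynomial (Fin n) ℝ) {x : E n} (hx : x ≠ 0)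
    (i : Fin n) :
    fderiv ℝ (fun y : E n => ‖y‖ ^ a * eval (fun i => y i) P) x (EuclideanSpace.single i 1) =
      a * (‖x‖ ^ (a - 2) * eval (fun i => x i) (X i * P)) +
        ‖x‖ ^ a * eval (fun i => x i) (pderiv i P) := by
  have hpos := norm_pos_iff.2 hx
  have hnorm := (hasStrictFDerivAt_norm_sq x).hasFDerivAt.rpow_const (p := a / 2)
    (Or.inl (by positivity))
  have hsq : ∀ (y : E n) (b : ℝ), (‖y‖ ^ 2) ^ b = ‖y‖ ^ (2 * b) := fun y b => by
    rw [← Real.rpow_natCast, ← Real.rpow_mul (norm_nonneg y), Nat.cast_ofNat]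
  simp only [hsq, mul_div_cancel₀ a (two_ne_zero' ℝ)] at hnorm
  rw [(hnorm.fun_mul (hasFDerivAt_eval P x)).fderiv]
  simp only [show 2 * (a / 2 - 1) = a - 2 by ring]
  simp [EuclideanSpace.inner_single_right]
  ring

lemma fderiv_single_mem_spanTset (hn : 0 < n) {u : E n → ℝ} (hu : u ∈ Tset n) (i : Fin n) :
    (fun x => fderiv ℝ u x (EuclideanSpace.single i 1)) ∈ spanTset n := by
  obtain ⟨j, l, k, m, p, hp, hjl, hlk, hmk, he, rfl⟩ := hu
  obtain ⟨P, hP, hpP⟩ := hp.exists_isHomogeneous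
  simp only [hpP]
  have h1 := norm_rpow_mul_eval_mem_spanTset hn hjl (show l ≤ k + 1 by omega)
    (show 1 + m ≤ k + 1 by omega) (by rwa [show k + 1 - (1 + m) = k - m by omega])
    ((isHomogeneous_X ℝ i).mul hP)
  have h2 : (fun x : E n => ‖x‖ ^ ((2 * (j : ℝ) - ((n : ℝ) - 2) * l - k) - m) *
      eval (fun i => x i) (pderiv i P)) ∈ spanTset n := by
    rcases m with _ | m
    · rw [← totalDegree_zero_iff_isHomogeneous, totalDegree_eq_zero_iff_eq_C] at hP
      rw [hP, pderiv_C]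
      exact mem_spanTset_of_eqOn (spanTset n).zero_mem fun x _ => by simp
    · have heven : Even (k + 1 - m) := by
        rw [show k + 1 - m = (k - (m + 1)) + 2 by omega]
        exact he.add even_two
      refine mem_spanTset_of_eqOn (norm_rpow_mul_eval_mem_spanTset hn hjl
        (show l ≤ k + 1 by omega) (show m ≤ k + 1 by omega) heven (hP.pderiv (i := i))) fun x _ => ?_
      push_cast
      ring_nf
  refine mem_spanTset_of_eqOn ((spanTset n).add_mem ((spanTset n).smul_mem
    ((2 * (j : ℝ) - ((n : ℝ) - 2) * l - k) - m) h1) h2) fun x hx => ?_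
  rw [fderiv_norm_rpow_mul_eval_single _ _ hx]
  simp only [Pi.add_apply, Pi.smul_apply, smul_eq_mul]
  push_cast
  ring_nf

lemma T2_subset_Tset (n : ℕ) : T2 n ⊆ Tset n := by
  rintro _ ⟨l, k, m, p, hp, hl, hlk, hmk, he, rfl⟩
  refine ⟨0, l, k, m, p, hp, by omega, hlk, hmk, he, ?_⟩
  funext x
  congr 2
  push_cast
  ring

end Tset

/-- properties of `𝒯` (`n ≥ 4`):
`𝒯₂ ⊆ 𝒯`, `SPAN(𝒯)` is closed under pointwise multiplication (as functions on
`ℝⁿ∖{0}`), and partial derivatives of elements of `𝒯` lie in `SPAN(𝒯)`. -/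
theorem Tset_properties (n : ℕ) (hn : 4 ≤ n) :
    T2 n ⊆ Tset n ∧
    (∀ u ∈ Submodule.span ℝ (Tset n), ∀ v ∈ Submodule.span ℝ (Tset n),
      ∃ w ∈ Submodule.span ℝ (Tset n), ∀ x : E n, x ≠ 0 → u x * v x = w x) ∧
    (∀ u ∈ Tset n, ∀ i : Fin n, ∃ w ∈ Submodule.span ℝ (Tset n),
      ∀ x : E n, x ≠ 0 → fderiv ℝ u x (EuclideanSpace.single i 1) = w x) := by
  exact ⟨T2_subset_Tset n, fun u hu v hv => mul_mem_spanTset (by omega) hu hv,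
    fun u hu i => fderiv_single_mem_spanTset (by omega) hu i⟩
end
end

section
/- Let n ≥ 4, R ≥ 1 and q ∈ ℕ. Let A be a set of smooth functions on {x ∈ ℝⁿ : |x| ≥ R} such that SPAN(A) is closed under pointwise multiplication and every element of A is O(0). Let g be a smooth map from {|x| ≥ R} to the n×n real matrices such that g(x) is invertible for every x, and such that each entry satisfies g_{ij} − δ_{ij} = O(−(n−1)) and has an expansion with terms in A up to order −q. Then each entry g^{ij} − δ_{ij} of the pointwise inverse matrix g(x)^{-1} also has an expansion with terms in A up to order −q. -/
open Real
open scoped BigOperators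

noncomputable section

/-- The exterior region `{x : ℝⁿ | R ≤ |x|}`. -/
def Sset (n : ℕ) (R : ℝ) : Set (E n) := {x : E n | R ≤ ‖x‖}

/-- `u = O(-q)` on `{|x| ≥ R}`: all rescaled iterated derivatives decay like `|x|^{-q}`. -/
def BigOh (n : ℕ) (R q : ℝ) (u : E n → ℝ) : Prop :=
  ∀ j : ℕ, ∃ C : ℝ, ∀ x ∈ Sset n R,
    ‖x‖ ^ j * ‖iteratedFDerivWithin ℝ j u (Sset n R) x‖ ≤ C * ‖x‖ ^ (-q)

/-- `u` has an expansion with terms in `A` up to order `-q` on `{|x| ≥ R}`. -/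
def HasExpansion (n : ℕ) (R : ℝ) (A : Set (E n → ℝ)) (q : ℝ) (u : E n → ℝ) : Prop :=
  ∃ ε : ℝ, ε ∈ Set.Ioo (0:ℝ) 1 ∧ ∃ v ∈ Submodule.span ℝ A,
    BigOh n R (q + ε) (fun x => u x - v x)

open Filter Topology

lemma uniqueDiffOn_Sset {n : ℕ} {R : ℝ} (hR : 0 < R) : UniqueDiffOn ℝ (Sset n R) := by
  intro x hx
  have hx' : R ≤ ‖x‖ := hx
  have hx0 : 0 < ‖x‖ := hR.trans_le hx'
  set H : Set (E n) := {y | ‖x‖ ^ 2 ≤ inner ℝ x y} with hH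
  have hsub : H ⊆ Sset n R := by
    intro y hy
    have h1 : ‖x‖ ^ 2 ≤ ‖x‖ * ‖y‖ := le_trans hy (real_inner_le_norm x y)
    have h2 : ‖x‖ ≤ ‖y‖ := by nlinarith
    exact hx'.trans h2
  have hconv : Convex ℝ H :=
    convex_halfSpace_ge (f := fun y => inner ℝ x y) (innerSL ℝ x).toLinearMap.isLinear _
  have hint : (interior H).Nonempty := by
    refine ⟨(2 : ℝ) • x, mem_interior.2 ⟨{y | ‖x‖ ^ 2 < inner ℝ x y}, ?_, ?_, ?_⟩⟩
    · intro y hy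
      have hy' : ‖x‖ ^ 2 < inner ℝ x y := hy
      exact hy'.le
    · exact isOpen_lt continuous_const (by fun_prop)
    · simp only [Set.mem_ofPred_eq, inner_smul_right, real_inner_self_eq_norm_sq]
      nlinarith [pow_pos hx0 2]
  refine (uniqueDiffWithinAt_convex hconv hint (subset_closure ?_)).mono hsub
  simp [hH]

/-- `u` is smooth on `{|x| ≥ R}` and `O(-p)` there. -/
structure IsSymbol (n : ℕ) (R p : ℝ) (u : E n → ℝ) : Prop where
  smooth : ContDiffOn ℝ (⊤ : ℕ∞) u (Sset n R)
  bigOh : BigOh n R p u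

namespace IsSymbol

variable {n : ℕ} {R p p' : ℝ} {u v : E n → ℝ}

lemma congr (hu : IsSymbol n R p u) (h : ∀ x ∈ Sset n R, v x = u x) : IsSymbol n R p v := by
  refine ⟨hu.smooth.congr h, fun j => ?_⟩
  obtain ⟨C, hC⟩ := hu.bigOh j
  refine ⟨C, fun x hx => ?_⟩
  rw [iteratedFDerivWithin_congr h hx]
  exact hC x hx

lemma mono (hR : 1 ≤ R) (hu : IsSymbol n R p u) (h : p' ≤ p) : IsSymbol n R p' u := by
  refine ⟨hu.smooth, fun j => ?_⟩
  obtain ⟨C, hC⟩ := hu.bigOh j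
  refine ⟨|C|, fun x hx => (hC x hx).trans ?_⟩
  have hx1 : 1 ≤ ‖x‖ := hR.trans hx
  gcongr
  exact le_abs_self C

lemma const (c : ℝ) : IsSymbol n R 0 (fun _ => c) := by
  refine ⟨contDiffOn_const, fun j => ⟨|c|, fun x _ => ?_⟩⟩
  rcases eq_or_ne j 0 with rfl | hj
  · simp
  · simp [iteratedFDerivWithin_const_of_ne hj]

lemma zero : IsSymbol n R p (fun _ => 0) := by
  refine ⟨contDiffOn_const, fun j => ⟨0, fun x _ => ?_⟩⟩
  rcases eq_or_ne j 0 with rfl | hj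
  · simp
  · simp [iteratedFDerivWithin_const_of_ne hj]

lemma add (hR : 1 ≤ R) (hu : IsSymbol n R p u) (hv : IsSymbol n R p v) :
    IsSymbol n R p (fun x => u x + v x) := by
  refine ⟨hu.smooth.add hv.smooth, fun j => ?_⟩
  obtain ⟨C, hC⟩ := hu.bigOh j
  obtain ⟨D, hD⟩ := hv.bigOh j
  refine ⟨C + D, fun x hx => ?_⟩
  have hj : (j : WithTop ℕ∞) ≤ ((⊤ : ℕ∞) : WithTop ℕ∞) := by exact_mod_cast le_top
  have h : iteratedFDerivWithin ℝ j (fun x => u x + v x) (Sset n R) x =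
      iteratedFDerivWithin ℝ j u (Sset n R) x + iteratedFDerivWithin ℝ j v (Sset n R) x :=
    iteratedFDerivWithin_add_apply ((hu.smooth x hx).of_le hj) ((hv.smooth x hx).of_le hj)
      (uniqueDiffOn_Sset (by linarith)) hx
  rw [h]
  calc _ ≤ ‖x‖ ^ j * (‖iteratedFDerivWithin ℝ j u (Sset n R) x‖ +
        ‖iteratedFDerivWithin ℝ j v (Sset n R) x‖) := by gcongr; exact norm_add_le _ _
    _ ≤ (C + D) * ‖x‖ ^ (-p) := by linarith [hC x hx, hD x hx]

lemma mul (hR : 1 ≤ R) (hu : IsSymbol n R p u) (hv : IsSymbol n R p' v) :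
    IsSymbol n R (p + p') (fun x => u x * v x) := by
  refine ⟨hu.smooth.mul hv.smooth, fun j => ?_⟩
  choose C hC using hu.bigOh
  choose D hD using hv.bigOh
  refine ⟨∑ i ∈ Finset.range (j + 1), (j.choose i : ℝ) * (C i * D (j - i)), fun x hx => ?_⟩
  have hx0 : 0 < ‖x‖ := by linarith [show R ≤ ‖x‖ from hx]
  have hj : (j : WithTop ℕ∞) ≤ ((⊤ : ℕ∞) : WithTop ℕ∞) := by exact_mod_cast le_top
  refine (mul_le_mul_of_nonneg_left (norm_iteratedFDerivWithin_mul_le hu.smooth hv.smooth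
    (uniqueDiffOn_Sset (by linarith)) hx hj) (by positivity)).trans ?_
  rw [Finset.mul_sum, Finset.sum_mul]
  refine Finset.sum_le_sum fun i hi => ?_
  have hij : i ≤ j := Nat.lt_succ_iff.1 (Finset.mem_range.1 hi)
  have h := mul_le_mul (hC i x hx) (hD (j - i) x hx) (by positivity)
    (le_trans (by positivity) (hC i x hx))
  rw [neg_add, Real.rpow_add hx0]
  have hpow : ‖x‖ ^ j = ‖x‖ ^ i * ‖x‖ ^ (j - i) := by rw [← pow_add, Nat.add_sub_cancel' hij]
  rw [hpow]
  calc _ = (j.choose i : ℝ) * (‖x‖ ^ i * ‖iteratedFDerivWithin ℝ i u (Sset n R) x‖ *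
        (‖x‖ ^ (j - i) * ‖iteratedFDerivWithin ℝ (j - i) v (Sset n R) x‖)) := by ring
    _ ≤ (j.choose i : ℝ) * (C i * ‖x‖ ^ (-p) * (D (j - i) * ‖x‖ ^ (-p'))) := by gcongr
    _ = _ := by ring

lemma const_mul (hR : 1 ≤ R) (c : ℝ) (hu : IsSymbol n R p u) :
    IsSymbol n R p (fun x => c * u x) := by
  simpa using (const c).mul hR hu

lemma sub (hR : 1 ≤ R) (hu : IsSymbol n R p u) (hv : IsSymbol n R p v) :
    IsSymbol n R p (fun x => u x - v x) :=
  (hu.add hR (hv.const_mul hR (-1))).congr fun x _ => by ring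

lemma sum (hR : 1 ≤ R) {ι : Type*} (s : Finset ι) {f : ι → E n → ℝ}
    (hf : ∀ i ∈ s, IsSymbol n R p (f i)) : IsSymbol n R p (fun x => ∑ i ∈ s, f i x) := by
  induction s using Finset.cons_induction with
  | empty => simpa using zero
  | cons a s ha ih =>
    simp only [Finset.sum_cons]
    exact (hf a (by simp)).add hR (ih fun i hi => hf i (by simp [hi]))

lemma prod (hR : 1 ≤ R) {ι : Type*} (s : Finset ι) {f : ι → E n → ℝ}
    (hf : ∀ i ∈ s, IsSymbol n R 0 (f i)) : IsSymbol n R 0 (fun x => ∏ i ∈ s, f i x) := by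
  induction s using Finset.cons_induction with
  | empty => simpa using const 1
  | cons a s ha ih =>
    simp only [Finset.prod_cons]
    simpa using (hf a (by simp)).mul hR (ih fun i hi => hf i (by simp [hi]))

lemma det (hR : 1 ≤ R) {ι : Type*} [Fintype ι] [DecidableEq ι] {M : E n → Matrix ι ι ℝ}
    (hM : ∀ i j, IsSymbol n R 0 (fun x => M x i j)) : IsSymbol n R 0 (fun x => (M x).det) := by
  simp only [Matrix.det_apply']
  exact sum hR _ fun σ _ => (prod hR _ fun i _ => hM _ _).const_mul hR _

lemma adjugate (hR : 1 ≤ R) {ι : Type*} [Fintype ι] [DecidableEq ι] {M : E n → Matrix ι ι ℝ}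
    (hM : ∀ i j, IsSymbol n R 0 (fun x => M x i j)) (i j : ι) :
    IsSymbol n R 0 (fun x => (M x).adjugate i j) := by
  simp only [Matrix.adjugate_apply]
  refine det hR fun k l => ?_
  by_cases hk : k = j
  · simpa [hk] using const (n := n) (R := R) ((Pi.single i (1 : ℝ) : ι → ℝ) l)
  · simpa [Matrix.updateRow_ne hk] using hM k l

lemma inv (hR : 1 ≤ R) (hu : IsSymbol n R 0 u) (hne : ∀ x ∈ Sset n R, u x ≠ 0) {B : ℝ}
    (hB : ∀ x ∈ Sset n R, |(u x)⁻¹| ≤ B) : IsSymbol n R 0 (fun x => (u x)⁻¹) := by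
  refine ⟨hu.smooth.inv hne, fun j => ?_⟩
  choose C hC using hu.bigOh
  set M : ℝ := 1 + ∑ i ∈ Finset.range (j + 1), |C i|
  have hM1 : 1 ≤ M := le_add_of_nonneg_right (Finset.sum_nonneg fun i _ => abs_nonneg _)
  refine ⟨j.factorial * (j.factorial * max 1 B ^ (j + 1)) * M ^ j, fun x hx => ?_⟩
  have hx0 : 0 < ‖x‖ := by linarith [show R ≤ ‖x‖ from hx]
  have hcomp : ‖iteratedFDerivWithin ℝ j (Inv.inv ∘ u) (Sset n R) x‖ ≤
      j.factorial * (j.factorial * max 1 B ^ (j + 1)) * (M / ‖x‖) ^ j := by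
    refine norm_iteratedFDerivWithin_comp_le (t := {0}ᶜ) (N := ((⊤ : ℕ∞) : WithTop ℕ∞))
      (contDiffOn_inv ℝ) hu.smooth (by exact_mod_cast le_top) isOpen_compl_singleton.uniqueDiffOn
      (uniqueDiffOn_Sset (by linarith)) hne hx (fun i hi => ?_) (fun i hi1 hi => ?_)
    · rw [iteratedFDerivWithin_of_isOpen i isOpen_compl_singleton (hne x hx),
        norm_iteratedFDeriv_eq_norm_iteratedDeriv, iteratedDeriv_eq_iterate, iter_deriv_inv]
      have hz : u x ^ (-1 - i : ℤ) = ((u x)⁻¹) ^ (i + 1) := by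
        rw [show (-1 - i : ℤ) = -((i + 1 : ℕ) : ℤ) by push_cast; ring, zpow_neg, zpow_natCast,
          inv_pow]
      rw [hz, norm_mul, norm_mul, norm_pow, norm_pow, norm_neg, norm_one, one_pow, one_mul,
        Real.norm_natCast, Real.norm_eq_abs]
      have h1 : |(u x)⁻¹| ^ (i + 1) ≤ max 1 B ^ (j + 1) :=
        (pow_le_pow_left₀ (abs_nonneg _) ((hB x hx).trans (le_max_right 1 B)) _).trans
          (pow_le_pow_right₀ (le_max_left 1 B) (by omega))
      gcongr
    · rw [div_pow, le_div_iff₀ (by positivity), mul_comm]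
      have h1 : C i ≤ M := by
        have := Finset.single_le_sum (f := fun i => |C i|) (fun i _ => abs_nonneg _)
          (Finset.mem_range.2 (Nat.lt_succ_of_le hi))
        linarith [le_abs_self (C i)]
      calc _ ≤ C i := by simpa using hC i x hx
        _ ≤ M := h1
        _ ≤ M ^ i := le_self_pow₀ hM1 (by omega)
  calc _ ≤ ‖x‖ ^ j * (j.factorial * (j.factorial * max 1 B ^ (j + 1)) * (M / ‖x‖) ^ j) := by
        gcongr; exact hcomp
    _ = _ := by
        rw [div_pow, neg_zero, Real.rpow_zero]
        field_simp

lemma tendsto_zero (hp : 0 < p) (hu : IsSymbol n R p u) :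
    Tendsto u (Bornology.cobounded (E n) ⊓ 𝓟 (Sset n R)) (𝓝 0) := by
  obtain ⟨C, hC⟩ := hu.bigOh 0
  have h0 : Tendsto (fun x : E n => C * ‖x‖ ^ (-p)) (Bornology.cobounded (E n) ⊓ 𝓟 (Sset n R))
      (𝓝 0) := by
    simpa using (((tendsto_rpow_neg_atTop hp).comp tendsto_norm_cobounded_atTop).const_mul
      C).mono_left inf_le_left
  refine squeeze_zero_norm' ?_ h0
  filter_upwards [mem_inf_of_right (mem_principal_self _)] with x hx
  simpa using hC x hx

end IsSymbol

/-- A matrix of symbols which is invertible on `{|x| ≥ R}` and tends to the identity at infinity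
has an inverse of order zero. -/
lemma isSymbol_inv_matrix {n : ℕ} {R p : ℝ} (hR : 1 ≤ R) (hp : 0 < p) {ι : Type*} [Fintype ι]
    [DecidableEq ι] {g : E n → Matrix ι ι ℝ} (hginv : ∀ x ∈ Sset n R, IsUnit (g x))
    (hg : ∀ i j, IsSymbol n R p (fun x => g x i j - (1 : Matrix ι ι ℝ) i j)) (i j : ι) :
    IsSymbol n R 0 (fun x => (g x)⁻¹ i j) := by
  have hg0 : ∀ i j, IsSymbol n R 0 (fun x => g x i j) := fun i j =>
    (((hg i j).mono hR hp.le).add hR (.const ((1 : Matrix ι ι ℝ) i j))).congr fun x _ => by ring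
  have hdet := IsSymbol.det hR hg0
  have hne : ∀ x ∈ Sset n R, (g x).det ≠ 0 := fun x hx =>
    ((Matrix.isUnit_iff_isUnit_det _).1 (hginv x hx)).ne_zero
  have hlim : Tendsto g (Bornology.cobounded (E n) ⊓ 𝓟 (Sset n R)) (𝓝 1) := by
    refine tendsto_pi_nhds.2 fun i => tendsto_pi_nhds.2 fun j => ?_
    simpa using ((hg i j).tendsto_zero hp).add_const ((1 : Matrix ι ι ℝ) i j)
  have hdetlim : Tendsto (fun x => |((g x).det)⁻¹|)
      (Bornology.cobounded (E n) ⊓ 𝓟 (Sset n R)) (𝓝 1) := by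
    have h1 : Tendsto (fun x => (g x).det) (Bornology.cobounded (E n) ⊓ 𝓟 (Sset n R)) (𝓝 1) := by
      simpa [Function.comp_def] using
        ((continuous_id.matrix_det).tendsto (1 : Matrix ι ι ℝ)).comp hlim
    simpa using (h1.inv₀ one_ne_zero).abs
  obtain ⟨r, -, hr⟩ := (hasBasis_cobounded_norm.inf_principal (Sset n R)).eventually_iff.1
    (hdetlim.eventually_le_const (show (1 : ℝ) < 2 by norm_num))
  have hclosed : IsClosed (Sset n R) := isClosed_le continuous_const continuous_norm
  obtain ⟨B, hB⟩ := ((isCompact_closedBall (0 : E n) r).inter_right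
    hclosed).exists_bound_of_continuousOn (f := fun x => ((g x).det)⁻¹)
    ((hdet.smooth.continuousOn.inv₀ hne).mono Set.inter_subset_right)
  have hbound : ∀ x ∈ Sset n R, |((g x).det)⁻¹| ≤ max 2 B := by
    intro x hx
    rcases le_total r ‖x‖ with h | h
    · exact (hr ⟨h, hx⟩).trans (le_max_left _ _)
    · exact (hB x ⟨by simpa using h, hx⟩).trans (le_max_right _ _)
  have hmul := (hdet.inv hR hne hbound).mul hR (IsSymbol.adjugate hR hg0 i j)
  rw [add_zero] at hmul
  exact hmul.congr fun x _ => by simp [Matrix.inv_def]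

lemma isSymbol_of_mem_span {n : ℕ} {R : ℝ} (hR : 1 ≤ R) {A : Set (E n → ℝ)}
    (hA : ∀ a ∈ A, IsSymbol n R 0 a) {v : E n → ℝ} (hv : v ∈ Submodule.span ℝ A) :
    IsSymbol n R 0 v := by
  induction hv using Submodule.span_induction with
  | mem a ha => exact hA a ha
  | zero => exact .zero
  | add u v _ _ hu hv => exact hu.add hR hv
  | smul c u _ hu => exact hu.const_mul hR c

/-- `u` is a symbol of order zero which has an expansion with terms in `A` up to order `-q`. -/
structure IsExpandable (n : ℕ) (R : ℝ) (A : Set (E n → ℝ)) (q : ℝ) (u : E n → ℝ) : Prop where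
  isSymbol : IsSymbol n R 0 u
  hasExpansion : HasExpansion n R A q u

namespace IsExpandable

variable {n : ℕ} {R q : ℝ} {A : Set (E n → ℝ)} {u v : E n → ℝ}

lemma of_isSymbol (hR : 1 ≤ R) (hq : 0 ≤ q) (hu : IsSymbol n R (q + 1) u) :
    IsExpandable n R A q u := by
  refine ⟨hu.mono hR (by linarith), 1 / 2, by norm_num, 0, Submodule.zero_mem _, ?_⟩
  simpa using (hu.mono hR (show q + 1 / 2 ≤ q + 1 by linarith)).bigOh

lemma congr (hu : IsExpandable n R A q u) (h : ∀ x ∈ Sset n R, v x = u x) :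
    IsExpandable n R A q v := by
  refine ⟨hu.isSymbol.congr h, ?_⟩
  obtain ⟨ε, hε, w, hw, hb⟩ := hu.hasExpansion
  refine ⟨ε, hε, w, hw, fun j => ?_⟩
  obtain ⟨C, hC⟩ := hb j
  refine ⟨C, fun x hx => ?_⟩
  rw [iteratedFDerivWithin_congr (f := fun x => u x - w x) (fun y hy => by simp [h y hy]) hx]
  exact hC x hx

lemma exists_isSymbol_sub (hR : 1 ≤ R) (hA : ∀ a ∈ A, IsSymbol n R 0 a)
    (hu : IsExpandable n R A q u) : ∃ ε ∈ Set.Ioo (0 : ℝ) 1, ∃ w ∈ Submodule.span ℝ A,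
      IsSymbol n R (q + ε) (fun x => u x - w x) := by
  obtain ⟨ε, hε, w, hw, hb⟩ := hu.hasExpansion
  exact ⟨ε, hε, w, hw, hu.isSymbol.smooth.sub (isSymbol_of_mem_span hR hA hw).smooth, hb⟩

lemma add (hR : 1 ≤ R) (hA : ∀ a ∈ A, IsSymbol n R 0 a) (hu : IsExpandable n R A q u)
    (hv : IsExpandable n R A q v) : IsExpandable n R A q (fun x => u x + v x) := by
  refine ⟨hu.isSymbol.add hR hv.isSymbol, ?_⟩
  obtain ⟨ε, hε, w, hw, hb⟩ := hu.exists_isSymbol_sub hR hA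
  obtain ⟨δ, hδ, z, hz, hc⟩ := hv.exists_isSymbol_sub hR hA
  refine ⟨min ε δ, ⟨lt_min hε.1 hδ.1, (min_le_left _ _).trans_lt hε.2⟩, w + z,
    Submodule.add_mem _ hw hz, ?_⟩
  refine (((hb.mono hR ?_).add hR (hc.mono hR ?_)).congr fun x _ => ?_).bigOh
  · linarith [min_le_left ε δ]
  · linarith [min_le_right ε δ]
  · simp only [Pi.add_apply]; ring

lemma mul (hR : 1 ≤ R) (hA : ∀ a ∈ A, IsSymbol n R 0 a)
    (hAmul : ∀ u ∈ Submodule.span ℝ A, ∀ v ∈ Submodule.span ℝ A,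
      ∃ w ∈ Submodule.span ℝ A, ∀ x ∈ Sset n R, u x * v x = w x)
    (hu : IsExpandable n R A q u) (hv : IsExpandable n R A q v) :
    IsExpandable n R A q (fun x => u x * v x) := by
  refine ⟨by simpa using hu.isSymbol.mul hR hv.isSymbol, ?_⟩
  obtain ⟨ε, hε, w, hw, hb⟩ := hu.exists_isSymbol_sub hR hA
  obtain ⟨δ, hδ, z, hz, hc⟩ := hv.exists_isSymbol_sub hR hA
  obtain ⟨y, hy, hwz⟩ := hAmul w hw z hz
  refine ⟨min ε δ, ⟨lt_min hε.1 hδ.1, (min_le_left _ _).trans_lt hε.2⟩, y, hy, ?_⟩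
  have h1 := hu.isSymbol.mul hR hc
  have h2 := hb.mul hR (isSymbol_of_mem_span hR hA hz)
  refine (((h1.mono hR ?_).add hR (h2.mono hR ?_)).congr fun x hx => ?_).bigOh
  · linarith [min_le_right ε δ]
  · linarith [min_le_left ε δ]
  · rw [← hwz x hx]; ring

lemma zero : IsExpandable n R A q (fun _ => 0) :=
  ⟨.zero, 1 / 2, by norm_num, 0, Submodule.zero_mem _, by simpa using IsSymbol.zero.bigOh⟩

lemma neg (hR : 1 ≤ R) (hA : ∀ a ∈ A, IsSymbol n R 0 a) (hu : IsExpandable n R A q u) :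
    IsExpandable n R A q (fun x => -u x) := by
  refine ⟨by simpa using hu.isSymbol.const_mul hR (-1), ?_⟩
  obtain ⟨ε, hε, w, hw, hb⟩ := hu.exists_isSymbol_sub hR hA
  refine ⟨ε, hε, -w, Submodule.neg_mem _ hw, ((hb.const_mul hR (-1)).congr fun x _ => ?_).bigOh⟩
  simp only [Pi.neg_apply]; ring

lemma sum (hR : 1 ≤ R) (hA : ∀ a ∈ A, IsSymbol n R 0 a) {ι : Type*} (s : Finset ι)
    {f : ι → E n → ℝ} (hf : ∀ i ∈ s, IsExpandable n R A q (f i)) :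
    IsExpandable n R A q (fun x => ∑ i ∈ s, f i x) := by
  induction s using Finset.cons_induction with
  | empty => simpa using zero
  | cons a s ha ih =>
    simp only [Finset.sum_cons]
    exact (hf a (by simp)).add hR hA (ih fun i hi => hf i (by simp [hi]))

end IsExpandable

lemma isSymbol_matrix_pow {n : ℕ} {R : ℝ} (hR : 1 ≤ R) {ι : Type*} [Fintype ι] [DecidableEq ι]
    {N : E n → Matrix ι ι ℝ} (hN : ∀ i j, IsSymbol n R 1 (fun x => N x i j)) (k : ℕ) (i j : ι) :
    IsSymbol n R k (fun x => (N x ^ k) i j) := by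
  induction k generalizing i j with
  | zero => simpa using IsSymbol.const ((1 : Matrix ι ι ℝ) i j)
  | succ k ih =>
    simp only [pow_succ, Matrix.mul_apply, Nat.cast_succ]
    exact .sum hR _ fun l _ => (ih i l).mul hR (hN l j)

lemma isExpandable_matrix_pow_succ {n : ℕ} {R q : ℝ} (hR : 1 ≤ R) {A : Set (E n → ℝ)}
    (hA : ∀ a ∈ A, IsSymbol n R 0 a)
    (hAmul : ∀ u ∈ Submodule.span ℝ A, ∀ v ∈ Submodule.span ℝ A,
      ∃ w ∈ Submodule.span ℝ A, ∀ x ∈ Sset n R, u x * v x = w x)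
    {ι : Type*} [Fintype ι] [DecidableEq ι] {N : E n → Matrix ι ι ℝ}
    (hN : ∀ i j, IsExpandable n R A q (fun x => N x i j)) (k : ℕ) (i j : ι) :
    IsExpandable n R A q (fun x => (N x ^ (k + 1)) i j) := by
  induction k generalizing i j with
  | zero => simpa using hN i j
  | succ k ih =>
    simp only [pow_succ _ (k + 1), Matrix.mul_apply]
    exact .sum hR hA _ fun l _ => (ih i l).mul hR hA hAmul (hN l j)

/-- The finite Neumann expansion of the inverse of `M`, with exact remainder. -/
lemma matrix_inv_sub_one_eq {ι : Type*} [Fintype ι] [DecidableEq ι] {M : Matrix ι ι ℝ}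
    (hM : IsUnit M) (k : ℕ) :
    M⁻¹ - 1 = ∑ i ∈ Finset.range k, (1 - M) ^ (i + 1) + M⁻¹ * (1 - M) ^ (k + 1) := by
  have h := congrArg (M⁻¹ * ·) (mul_neg_geom_sum (1 - M) (k + 1))
  simp only [sub_sub_cancel, mul_sub, mul_one] at h
  rw [← mul_assoc, Matrix.nonsing_inv_mul M ((Matrix.isUnit_iff_isUnit_det M).1 hM), one_mul,
    Finset.sum_range_succ', pow_zero] at h
  rw [sub_eq_iff_eq_add]
  exact (eq_sub_iff_add_eq.1 h).symm.trans (add_right_comm _ _ _)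

/-- the entries of the inverse of a matrix of expandable functions
again have expansions. -/
theorem inverse_matrix_has_expansion (n : ℕ) (hn : 4 ≤ n) (R : ℝ) (hR : 1 ≤ R) (q : ℕ)
    (A : Set (E n → ℝ))
    (hAsmooth : ∀ a ∈ A, ContDiffOn ℝ (⊤ : ℕ∞) a (Sset n R))
    (hAO : ∀ a ∈ A, BigOh n R 0 a)
    (hAmul : ∀ u ∈ Submodule.span ℝ A, ∀ v ∈ Submodule.span ℝ A,
      ∃ w ∈ Submodule.span ℝ A, ∀ x ∈ Sset n R, u x * v x = w x)
    (g : E n → Matrix (Fin n) (Fin n) ℝ)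
    (hginv : ∀ x ∈ Sset n R, IsUnit (g x))
    (hgsmooth : ∀ i j : Fin n, ContDiffOn ℝ (⊤ : ℕ∞) (fun x => g x i j) (Sset n R))
    (hgO : ∀ i j : Fin n,
      BigOh n R ((n:ℝ) - 1) (fun x => g x i j - if i = j then 1 else 0))
    (hgexp : ∀ i j : Fin n,
      HasExpansion n R A q (fun x => g x i j - if i = j then 1 else 0)) :
    ∀ i j : Fin n,
      HasExpansion n R A q (fun x => (g x)⁻¹ i j - if i = j then 1 else 0) := by
  have hone : ∀ i j : Fin n, (if i = j then (1 : ℝ) else 0) = (1 : Matrix (Fin n) (Fin n) ℝ) i j :=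
    fun i j => Matrix.one_apply.symm
  simp only [hone] at hgO hgexp ⊢
  have hn' : (4 : ℝ) ≤ n := by exact_mod_cast hn
  have hA : ∀ a ∈ A, IsSymbol n R 0 a := fun a ha => ⟨hAsmooth a ha, hAO a ha⟩
  have hg : ∀ i j, IsSymbol n R 1 (fun x => g x i j - (1 : Matrix (Fin n) (Fin n) ℝ) i j) :=
    fun i j => IsSymbol.mono hR ⟨(hgsmooth i j).sub contDiffOn_const, hgO i j⟩ (by linarith)
  have hN : ∀ i j, IsSymbol n R 1 (fun x => (1 - g x) i j) := fun i j =>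
    ((hg i j).const_mul hR (-1)).congr fun x _ => by simp
  have hNexp : ∀ i j, IsExpandable n R A q (fun x => (1 - g x) i j) := fun i j =>
    (IsExpandable.neg hR hA ⟨(hg i j).mono hR zero_le_one, hgexp i j⟩).congr fun x _ => by simp
  intro i j
  have hrem : IsExpandable n R A q (fun x => ((g x)⁻¹ * (1 - g x) ^ (q + 1)) i j) := by
    refine .of_isSymbol hR q.cast_nonneg ?_
    simp only [Matrix.mul_apply]
    refine .sum hR _ fun l _ => ?_
    simpa using (isSymbol_inv_matrix hR one_pos hginv hg i l).mul hR
      (isSymbol_matrix_pow hR hN (q + 1) l j)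
  refine (((IsExpandable.sum hR hA (Finset.range q) fun k _ =>
    isExpandable_matrix_pow_succ hR hA hAmul hNexp k i j).add hR hA hrem).congr
      fun x hx => ?_).hasExpansion
  rw [← Matrix.sub_apply, matrix_inv_sub_one_eq (hginv x hx) q, Matrix.add_apply,
    Matrix.sum_apply]
end
end
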